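/- With notation as in the nonbasic weight lemma, equality nbw(ν̃) = nbw(π̃₁) + nbw(π̃₂) holds (for D_ν̃ appearing with nonzero coefficient in D_{π̃₁} D_{π̃₂}) if and only if the multiset of nonbasic blocks of ν̃ equals the multiset union of the nonbasic blocks of π̃₁ and of π̃₂: N(ν̃) = N(π̃₁) ⊎ N(π̃₂). -/

import Mathlib

open Finset
open scoped Classical

variable {r k : ℕ}

/-- The coloring map on the two-row alphabet: unbarred (top) elements are colored by `f`
and barred (bottom) elements by `g`. -/
def colorOf (f g : Fin r → Fin k) : Fin r ⊕ Fin r → Fin k ⊕ Fin k := Sum.map f g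

/-- The multiset partition obtained by coloring all elements of a set partition of the
two-row alphabet. -/
def coloredP (f g : Fin r → Fin k) (P : Finpartition (univ : Finset (Fin r ⊕ Fin r))) :
    Multiset (Multiset (Fin k ⊕ Fin k)) :=
  P.parts.val.map fun B => B.val.map (colorOf f g)

/-- Two elements lie in a common block of the set partition `P`. -/
def memRel (P : Finpartition (univ : Finset (Fin r ⊕ Fin r))) (x y : Fin r ⊕ Fin r) : Prop :=
  ∃ B ∈ P.parts, x ∈ B ∧ y ∈ B

/-- Embedding of the two-row alphabet of the first (upper) diagram into the three-row
alphabet `top ⊕ (middle ⊕ bottom)`: top ↦ top, bottom ↦ middle. -/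
def emb12 : Fin r ⊕ Fin r → Fin r ⊕ (Fin r ⊕ Fin r) := Sum.map id Sum.inl

/-- Embedding of the two-row alphabet of the second (lower) diagram: top ↦ middle,
bottom ↦ bottom. -/
def emb23 : Fin r ⊕ Fin r → Fin r ⊕ (Fin r ⊕ Fin r) := Sum.inr

/-- Embedding of the outer two rows: top ↦ top, bottom ↦ bottom. -/
def emb13 : Fin r ⊕ Fin r → Fin r ⊕ (Fin r ⊕ Fin r) := Sum.map id Sum.inr

/-- The relation on the three-tier diagram generated by the blocks of the two stacked
diagrams (identifying the bottom row of the first with the top row of the second). -/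
def stackRel (P₁ P₂ : Finpartition (univ : Finset (Fin r ⊕ Fin r))) :
    Fin r ⊕ (Fin r ⊕ Fin r) → Fin r ⊕ (Fin r ⊕ Fin r) → Prop :=
  Relation.EqvGen fun x y =>
    (∃ a b, emb12 a = x ∧ emb12 b = y ∧ memRel P₁ a b) ∨
    (∃ a b, emb23 a = x ∧ emb23 b = y ∧ memRel P₂ a b)

/-- `ν` is the diagram product of `P₁` and `P₂`: its blocks are the restriction to the
outer two rows of the connected components of the stacked three-tier diagram. -/
def IsDiagramProduct (P₁ P₂ ν : Finpartition (univ : Finset (Fin r ⊕ Fin r))) : Prop :=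
  ∀ x y, memRel ν x y ↔ stackRel P₁ P₂ (emb13 x) (emb13 y)

/-- A vertical bar: a block of the form `{i, ī}`. -/
def isVBar (Bl : Multiset (Fin k ⊕ Fin k)) : Prop :=
  ∃ i, Bl = {Sum.inl i, Sum.inr i}

/-- A nonbasic block: one that is neither a singleton nor a vertical bar. -/
def isNonbasic (Bl : Multiset (Fin k ⊕ Fin k)) : Prop :=
  Multiset.card Bl ≠ 1 ∧ ¬ isVBar Bl

/-- `N(π̃)` : the multiset of nonbasic blocks of a multiset partition. -/
noncomputable def nbBlocks (M : Multiset (Multiset (Fin k ⊕ Fin k))) :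
    Multiset (Multiset (Fin k ⊕ Fin k)) :=
  M.filter isNonbasic

/-- The nonbasic weight `nbw(π̃) = Σ_{B̃ ∈ N(π̃)} |B̃|`. -/
noncomputable def nbw (M : Multiset (Multiset (Fin k ⊕ Fin k))) : ℕ :=
  ((nbBlocks M).map Multiset.card).sum

/-- The block of `x` for a relation `R`, as a finset. -/
noncomputable def relBlock (R : Fin r ⊕ Fin r → Fin r ⊕ Fin r → Prop) (x : Fin r ⊕ Fin r) :
    Finset (Fin r ⊕ Fin r) :=
  univ.filter (R x)

/-- The colored block of `x` for a relation `R`. -/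
noncomputable def colBlock (f g : Fin r → Fin k)
    (R : Fin r ⊕ Fin r → Fin r ⊕ Fin r → Prop) (x : Fin r ⊕ Fin r) :
    Multiset (Fin k ⊕ Fin k) :=
  (relBlock R x).val.map (colorOf f g)

/-- `{i, j̄}` is a block of `R` whose two elements have the same color. -/
def BarAt (f g : Fin r → Fin k) (R : Fin r ⊕ Fin r → Fin r ⊕ Fin r → Prop)
    (i j : Fin r) : Prop :=
  R (.inl i) (.inr j) ∧ f i = g j ∧ ∀ y, R (.inl i) y → y = .inl i ∨ y = .inr j

/-- The relation `R` turned upside down. -/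
def flipRel (R : Fin r ⊕ Fin r → Fin r ⊕ Fin r → Prop) :
    Fin r ⊕ Fin r → Fin r ⊕ Fin r → Prop :=
  fun x y => R x.swap y.swap

/-- The equivalence relation on the three-tier diagram generated by two stacked relations. -/
def stackGen (R₁ R₂ : Fin r ⊕ Fin r → Fin r ⊕ Fin r → Prop) :
    Fin r ⊕ (Fin r ⊕ Fin r) → Fin r ⊕ (Fin r ⊕ Fin r) → Prop :=
  Relation.EqvGen fun x y =>
    (∃ a b, emb12 a = x ∧ emb12 b = y ∧ R₁ a b) ∨
    (∃ a b, emb23 a = x ∧ emb23 b = y ∧ R₂ a b)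

/-- `N` is the stacking product of `R₁` and `R₂`. -/
def IsStack (R₁ R₂ N : Fin r ⊕ Fin r → Fin r ⊕ Fin r → Prop) : Prop :=
  ∀ x y, N x y ↔ stackGen R₁ R₂ (emb13 x) (emb13 y)

section Relations

variable {f g h : Fin r → Fin k} {R R₁ R₂ N : Fin r ⊕ Fin r → Fin r ⊕ Fin r → Prop}

lemma mem_relBlock {x y : Fin r ⊕ Fin r} : y ∈ relBlock R x ↔ R x y := by
  simp [relBlock]

lemma relBlock_eq (hR : Equivalence R) {x y : Fin r ⊕ Fin r} (hxy : R x y) :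
    relBlock R x = relBlock R y := by
  ext z
  simp only [mem_relBlock]
  exact ⟨fun hz => hR.trans (hR.symm hxy) hz, fun hz => hR.trans hxy hz⟩

lemma colBlock_eq (hR : Equivalence R) {x y : Fin r ⊕ Fin r} (hxy : R x y) :
    colBlock f g R x = colBlock f g R y := by
  rw [colBlock, colBlock, relBlock_eq hR hxy]

lemma BarAt.right (hR : Equivalence R) {i j : Fin r} (hb : BarAt f g R i j)
    {y : Fin r ⊕ Fin r} (hy : R (.inr j) y) : y = .inl i ∨ y = .inr j :=
  hb.2.2 y (hR.trans hb.1 hy)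

lemma BarAt.top_unique (hR : Equivalence R) {i i' j : Fin r} (hb : BarAt f g R i j)
    (hb' : BarAt f g R i' j) : i = i' := by
  have := hb.right hR (hR.symm hb'.1)
  simpa [eq_comm] using this

lemma BarAt.bot_unique {i j j' : Fin r} (hb : BarAt f g R i j)
    (hb' : BarAt f g R i j') : j = j' := by
  have := hb.2.2 _ hb'.1
  simpa [eq_comm] using this

lemma BarAt.colBlock_inl (hR : Equivalence R) {i j : Fin r} (hb : BarAt f g R i j) :
    colBlock f g R (.inl i) = {.inl (f i), .inr (f i)} := by
  have : relBlock R (.inl i) = {.inl i, .inr j} := by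
    ext y
    simp only [mem_relBlock, mem_insert, mem_singleton]
    exact ⟨hb.2.2 y, by rintro (rfl | rfl); exacts [hR.refl _, hb.1]⟩
  rw [colBlock, this]
  simp [colorOf, hb.2.1, ← Multiset.singleton_add, Multiset.insert_eq_cons]

lemma not_isNonbasic_of_forall_eq (hR : Equivalence R) {x : Fin r ⊕ Fin r}
    (hx : ∀ y, R x y → y = x) : ¬ isNonbasic (colBlock f g R x) := by
  have : relBlock R x = {x} := by
    ext y
    simp only [mem_relBlock, mem_singleton]
    exact ⟨hx y, by rintro rfl; exact hR.refl _⟩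
  simp [isNonbasic, colBlock, this]

lemma BarAt.not_isNonbasic (hR : Equivalence R) {i j : Fin r} (hb : BarAt f g R i j) :
    ¬ isNonbasic (colBlock f g R (.inl i)) := fun hn =>
  hn.2 ⟨f i, hb.colBlock_inl hR⟩

lemma basic_cases (hR : Equivalence R) {x : Fin r ⊕ Fin r}
    (hx : ¬ isNonbasic (colBlock f g R x)) :
    (∀ y, R x y → y = x) ∨ ∃ i j, BarAt f g R i j ∧ (x = .inl i ∨ x = .inr j) := by
  have hxx : x ∈ relBlock R x := mem_relBlock.2 (hR.refl x)
  rw [isNonbasic, not_and_or, not_not, not_not] at hx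
  rcases hx with hc | ⟨i, hi⟩
  · left
    intro y hy
    rw [colBlock, Multiset.card_map, card_val, card_eq_one] at hc
    obtain ⟨a, ha⟩ := hc
    have hy' := mem_relBlock.2 hy
    rw [ha, mem_singleton] at hxx hy'
    rw [hxx, hy']
  · right
    have hcard : (relBlock R x).card = 2 := by
      have := congrArg Multiset.card hi
      simpa [colBlock] using this
    have h1 : (Sum.inl i : Fin k ⊕ Fin k) ∈ colBlock f g R x := by simp [hi]
    have h2 : (Sum.inr i : Fin k ⊕ Fin k) ∈ colBlock f g R x := by simp [hi]
    obtain ⟨a, ha, hai⟩ := Multiset.mem_map.1 h1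
    obtain ⟨b, hb, hbi⟩ := Multiset.mem_map.1 h2
    rcases a with a | a <;> simp [colorOf] at hai
    rcases b with b | b <;> simp [colorOf] at hbi
    have hsub : ({.inl a, .inr b} : Finset (Fin r ⊕ Fin r)) = relBlock R x := by
      apply eq_of_subset_of_card_le
      · intro z hz
        rw [mem_insert, mem_singleton] at hz
        rcases hz with rfl | rfl
        exacts [ha, hb]
      · rw [hcard]; simp
    have hxa : R x (.inl a) := mem_relBlock.1 ha
    have hxb : R x (.inr b) := mem_relBlock.1 hb
    refine ⟨a, b, ⟨hR.trans (hR.symm hxa) hxb, by rw [hai, hbi], fun y hy => ?_⟩, ?_⟩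
    · have := mem_relBlock.2 (hR.trans hxa hy)
      rw [← hsub] at this
      simpa using this
    · rw [← hsub] at hxx
      simpa using hxx

lemma stackGen.of_closed (hR₁ : Equivalence R₁) (hR₂ : Equivalence R₂)
    {S : Fin r ⊕ (Fin r ⊕ Fin r) → Prop}
    (h₁ : ∀ a b, R₁ a b → S (emb12 a) → S (emb12 b))
    (h₂ : ∀ a b, R₂ a b → S (emb23 a) → S (emb23 b))
    {x y : Fin r ⊕ (Fin r ⊕ Fin r)} (hxy : stackGen R₁ R₂ x y) (hx : S x) : S y := by
  have key : S x ↔ S y := by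
    clear hx
    induction hxy with
    | rel x y hxy =>
      rcases hxy with ⟨a, b, rfl, rfl, hab⟩ | ⟨a, b, rfl, rfl, hab⟩
      · exact ⟨h₁ _ _ hab, h₁ _ _ (hR₁.symm hab)⟩
      · exact ⟨h₂ _ _ hab, h₂ _ _ (hR₂.symm hab)⟩
    | refl x => rfl
    | symm x y _ ih => exact ih.symm
    | trans x y z _ _ ih ih' => exact ih.trans ih'
  exact key.1 hx

lemma stackGen.upper {a b : Fin r ⊕ Fin r} (hab : R₁ a b) :
    stackGen R₁ R₂ (emb12 a) (emb12 b) :=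
  .rel _ _ (.inl ⟨a, b, rfl, rfl, hab⟩)

lemma stackGen.lower {a b : Fin r ⊕ Fin r} (hab : R₂ a b) :
    stackGen R₁ R₂ (emb23 a) (emb23 b) :=
  .rel _ _ (.inr ⟨a, b, rfl, rfl, hab⟩)

lemma equivalence_flipRel (hR : Equivalence R) : Equivalence (flipRel R) :=
  ⟨fun _ => hR.refl _, fun h => hR.symm h, fun h h' => hR.trans h h'⟩

lemma flipRel_flipRel : flipRel (flipRel R) = R := by
  funext x y
  simp [flipRel]

lemma stackGen.flip {x y : Fin r ⊕ (Fin r ⊕ Fin r)} (hxy : stackGen R₁ R₂ x y) :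
    stackGen (flipRel R₂) (flipRel R₁)
      (Sum.elim (Sum.inr ∘ Sum.inr) (Sum.elim (Sum.inr ∘ Sum.inl) Sum.inl) x)
      (Sum.elim (Sum.inr ∘ Sum.inr) (Sum.elim (Sum.inr ∘ Sum.inl) Sum.inl) y) := by
  induction hxy with
  | rel x y hxy =>
    rcases hxy with ⟨a, b, rfl, rfl, hab⟩ | ⟨a, b, rfl, rfl, hab⟩
    · have : flipRel R₁ a.swap b.swap := by simpa [flipRel] using hab
      have := stackGen.lower (R₁ := flipRel R₂) this
      rcases a with a | a <;> rcases b with b | b <;> exact this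
    · have : flipRel R₂ a.swap b.swap := by simpa [flipRel] using hab
      have := stackGen.upper (R₂ := flipRel R₁) this
      rcases a with a | a <;> rcases b with b | b <;> exact this
  | refl x => exact .refl _
  | symm x y _ ih => exact .symm _ _ ih
  | trans x y z _ _ ih ih' => exact .trans _ _ _ ih ih'

lemma IsStack.flip (hN : IsStack R₁ R₂ N) :
    IsStack (flipRel R₂) (flipRel R₁) (flipRel N) := by
  intro x y
  rw [flipRel, hN]
  constructor
  · intro hxy
    have := hxy.flip
    rcases x with x | x <;> rcases y with y | y <;> exact this
  · intro hxy
    have := hxy.flip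
    rw [flipRel_flipRel, flipRel_flipRel] at this
    rcases x with x | x <;> rcases y with y | y <;> exact this

lemma BarAt.flip (hR : Equivalence R) {i j : Fin r} (hb : BarAt f g R i j) :
    BarAt g f (flipRel R) j i := by
  refine ⟨hR.symm hb.1, hb.2.1.symm, fun y hy => ?_⟩
  have := hb.right hR (y := y.swap) hy
  rcases y with y | y <;> simpa using this

lemma barAt_flipRel (hR : Equivalence R) {i j : Fin r} :
    BarAt g f (flipRel R) j i ↔ BarAt f g R i j := by
  refine ⟨fun hb => ?_, BarAt.flip hR⟩
  have := hb.flip (equivalence_flipRel hR)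
  rwa [flipRel_flipRel] at this

lemma colBlock_flipRel (x : Fin r ⊕ Fin r) :
    colBlock g f (flipRel R) x = (colBlock f g R x.swap).map Sum.swap := by
  have : relBlock (flipRel R) x = (relBlock R x.swap).map (Equiv.sumComm _ _).toEmbedding := by
    ext y
    simp [mem_relBlock, flipRel]
  rw [colBlock, this, colBlock, map_val, Multiset.map_map, Multiset.map_map]
  refine Multiset.map_congr rfl fun y _ => ?_
  rcases y with y | y <;> simp [colorOf]

lemma isNonbasic_map_swap {S : Multiset (Fin k ⊕ Fin k)} :
    isNonbasic (S.map Sum.swap) ↔ isNonbasic S := by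
  have key : ∀ S : Multiset (Fin k ⊕ Fin k), isVBar S → isVBar (S.map Sum.swap) := by
    rintro _ ⟨i, rfl⟩
    exact ⟨i, by simpa using Multiset.pair_comm _ _⟩
  have : isVBar (S.map Sum.swap) ↔ isVBar S := by
    refine ⟨fun hS => ?_, key S⟩
    simpa [Multiset.map_map] using key _ hS
  rw [isNonbasic, isNonbasic, this, Multiset.card_map]

lemma isNonbasic_flipRel {x : Fin r ⊕ Fin r} :
    isNonbasic (colBlock g f (flipRel R) x) ↔ isNonbasic (colBlock f g R x.swap) := by
  rw [colBlock_flipRel, isNonbasic_map_swap]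

/-- A top element whose block in the product is nonbasic lies in a nonbasic block of the upper
diagram, or a bar of the upper diagram joins it to a nonbasic block of the lower one. -/
lemma nonbasic_top (hR₁ : Equivalence R₁) (hR₂ : Equivalence R₂) (hE : Equivalence N)
    (hN : IsStack R₁ R₂ N) {t : Fin r} (ht : isNonbasic (colBlock f h N (.inl t))) :
    isNonbasic (colBlock f g R₁ (.inl t)) ∨
      ∃ m, BarAt f g R₁ t m ∧ isNonbasic (colBlock g h R₂ (.inl m)) := by
  by_contra! hcon
  obtain ⟨h1, h2⟩ := hcon
  rcases basic_cases hR₁ h1 with hs | ⟨i, m, hb, hx⟩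
  · refine not_isNonbasic_of_forall_eq hE (fun y hy => ?_) ht
    have := stackGen.of_closed hR₁ hR₂ (S := fun z => z = Sum.inl t) ?_ ?_ ((hN _ _).1 hy) rfl
    · rcases y with y | y <;> simp_all [emb13]
    · rintro (a | a) b hab ha <;> simp [emb12] at ha
      subst ha
      rw [hs b hab]
      rfl
    · intro a b _ ha
      simp [emb23] at ha
  · obtain rfl : t = i := by simpa using hx
    rcases basic_cases hR₂ (h2 m hb) with hs | ⟨m', u, hb', hx'⟩
    · refine not_isNonbasic_of_forall_eq hE (fun y hy => ?_) ht
      have := stackGen.of_closed hR₁ hR₂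
        (S := fun z => z = Sum.inl t ∨ z = Sum.inr (Sum.inl m)) ?_ ?_ ((hN _ _).1 hy) (.inl rfl)
      · rcases y with y | y <;> simp_all [emb13]
      · rintro (a | a) b hab ha <;> simp [emb12] at ha <;> subst ha
        · rcases hb.2.2 b hab with rfl | rfl <;> simp [emb12]
        · rcases hb.right hR₁ hab with rfl | rfl <;> simp [emb12]
      · rintro (a | a) b hab ha <;> simp [emb23] at ha
        subst ha
        rw [hs b hab]
        simp [emb23]
    · obtain rfl : m = m' := by simpa using hx'
      refine BarAt.not_isNonbasic hE (j := u) ⟨?_, hb.2.1.trans hb'.2.1, fun y hy => ?_⟩ ht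
      · rw [hN]
        exact .trans _ _ _ (stackGen.upper hb.1) (stackGen.lower hb'.1)
      have := stackGen.of_closed hR₁ hR₂
        (S := fun z => z = Sum.inl t ∨ z = Sum.inr (Sum.inl m) ∨ z = Sum.inr (Sum.inr u))
        ?_ ?_ ((hN _ _).1 hy) (.inl rfl)
      · rcases y with y | y <;> simp_all [emb13]
      · rintro (a | a) b hab ha <;> simp [emb12] at ha <;> subst ha
        · rcases hb.2.2 b hab with rfl | rfl <;> simp [emb12]
        · rcases hb.right hR₁ hab with rfl | rfl <;> simp [emb12]
      · rintro (a | a) b hab ha <;> simp [emb23] at ha <;> subst ha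
        · rcases hb'.2.2 b hab with rfl | rfl <;> simp [emb23]
        · rcases hb'.right hR₂ hab with rfl | rfl <;> simp [emb23]

lemma nonbasic_bot (hR₁ : Equivalence R₁) (hR₂ : Equivalence R₂) (hE : Equivalence N)
    (hN : IsStack R₁ R₂ N) {u : Fin r} (hu : isNonbasic (colBlock f h N (.inr u))) :
    isNonbasic (colBlock g h R₂ (.inr u)) ∨
      ∃ m, BarAt g h R₂ m u ∧ isNonbasic (colBlock f g R₁ (.inr m)) := by
  have := nonbasic_top (f := h) (g := g) (h := f) (t := u) (equivalence_flipRel hR₂)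
    (equivalence_flipRel hR₁) (equivalence_flipRel hE) hN.flip (isNonbasic_flipRel.2 hu)
  simpa only [isNonbasic_flipRel, barAt_flipRel hR₂, Sum.swap_inl] using this

/-- If bars of the lower diagram continue every middle element of the nonbasic blocks of the
upper diagram, then these blocks appear, with the same colors, in the product. -/
lemma colBlock_eq_upper (hR₁ : Equivalence R₁) (hR₂ : Equivalence R₂)
    (hN : IsStack R₁ R₂ N) {q : Fin r → Fin r}
    (hq : ∀ m, isNonbasic (colBlock f g R₁ (.inr m)) → BarAt g h R₂ m (q m))
    {y : Fin r ⊕ Fin r} (hy : isNonbasic (colBlock f g R₁ y)) :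
    colBlock f h N (Sum.map id q y) = colBlock f g R₁ y := by
  have hnb : ∀ z, R₁ y z → isNonbasic (colBlock f g R₁ z) := fun z hz => by
    rwa [← colBlock_eq hR₁ hz]
  have hconn : ∀ z, R₁ y z → stackGen R₁ R₂ (emb12 z) (emb13 (Sum.map id q z)) := by
    rintro (z | z) hz
    · exact .refl _
    · exact stackGen.lower (hq z (hnb _ hz)).1
  have hblock : relBlock N (Sum.map id q y) = (relBlock R₁ y).image (Sum.map id q) := by
    ext x
    simp only [mem_image, mem_relBlock, hN _ _]
    constructor
    · intro hx
      have := stackGen.of_closed hR₁ hR₂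
        (S := fun z => ∃ y', R₁ y y' ∧ (z = emb12 y' ∨ z = emb13 (Sum.map id q y')))
        ?_ ?_ hx ⟨y, hR₁.refl y, .inr rfl⟩
      · obtain ⟨y', hy', hxy'⟩ := this
        refine ⟨y', hy', ?_⟩
        rcases x with x | x <;> rcases y' with y' | y' <;> simp_all [emb12, emb13]
      · rintro a b hab ⟨y', hy', ha⟩
        have hay : a = y' := by
          rcases a with a | a <;> rcases y' with y' | y' <;> simp_all [emb12, emb13]
        subst hay
        exact ⟨b, hR₁.trans hy' hab, .inl rfl⟩
      · rintro a b hab ⟨y' | m, hy', ha⟩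
        · simp [emb12, emb13, emb23] at ha
        · refine ⟨.inr m, hy', ?_⟩
          have hbar := hq m (hnb _ hy')
          have hab' : b = .inl m ∨ b = .inr (q m) := by
            rcases ha with ha | ha <;> simp [emb12, emb13, emb23] at ha <;> subst ha
            · exact hbar.2.2 b hab
            · exact hbar.right hR₂ hab
          rcases hab' with rfl | rfl <;> simp [emb12, emb13, emb23]
    · rintro ⟨z, hz, rfl⟩
      exact .trans _ _ _ (.symm _ _ (hconn y (hR₁.refl y)))
        (.trans _ _ _ (stackGen.upper hz) (hconn z hz))
  have hinj : Set.InjOn (Sum.map id q) (relBlock R₁ y : Set (Fin r ⊕ Fin r)) := by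
    rintro (a | a) ha (b | b) hb hab <;> simp at hab
    · rw [hab]
    · rw [mem_coe, mem_relBlock] at ha hb
      have hbb := hq b (hnb _ hb)
      rw [← hab] at hbb
      rw [(hq a (hnb _ ha)).top_unique hR₂ hbb]
  rw [colBlock, hblock, image_val_of_injOn hinj, Multiset.map_map, colBlock]
  refine Multiset.map_congr rfl ?_
  rintro (z | z) hz
  · rfl
  · have := hq z (hnb _ (mem_relBlock.1 hz))
    simp [colorOf, this.2.1]

lemma colBlock_eq_lower (hR₁ : Equivalence R₁) (hR₂ : Equivalence R₂)
    (hN : IsStack R₁ R₂ N) {q : Fin r → Fin r}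
    (hq : ∀ m, isNonbasic (colBlock g h R₂ (.inl m)) → BarAt f g R₁ (q m) m)
    {y : Fin r ⊕ Fin r} (hy : isNonbasic (colBlock g h R₂ y)) :
    colBlock f h N (Sum.map q id y) = colBlock g h R₂ y := by
  have := colBlock_eq_upper (f := h) (g := g) (h := f) (q := q) (y := y.swap)
    (equivalence_flipRel hR₂) (equivalence_flipRel hR₁) hN.flip
    (fun m hm => (barAt_flipRel hR₁).2 (hq m (isNonbasic_flipRel.1 hm)))
    (isNonbasic_flipRel.2 (by simpa using hy))
  rw [colBlock_flipRel, colBlock_flipRel] at this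
  have := Multiset.map_injective Sum.swap_leftInverse.injective this
  rcases y with y | y <;> simpa using this

/-- `x` in the product corresponds to `y` in a nonbasic block of the upper (left summand) or
lower (right summand) diagram. -/
def Corresp (f g h : Fin r → Fin k) (R₁ R₂ : Fin r ⊕ Fin r → Fin r ⊕ Fin r → Prop) :
    Fin r ⊕ Fin r → (Fin r ⊕ Fin r) ⊕ (Fin r ⊕ Fin r) → Prop
  | .inl t, .inl (.inl t') => t = t'
  | .inl t, .inr (.inl m) => BarAt f g R₁ t m
  | .inr u, .inl (.inr m) => BarAt g h R₂ m u
  | .inr u, .inr (.inr u') => u = u'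
  | _, _ => False

lemma Corresp.left_unique (hR₁ : Equivalence R₁) {x x' : Fin r ⊕ Fin r}
    {y : (Fin r ⊕ Fin r) ⊕ (Fin r ⊕ Fin r)} (hx : Corresp f g h R₁ R₂ x y)
    (hz : Corresp f g h R₁ R₂ x' y) : x = x' := by
  rcases x with x | x <;> rcases x' with x' | x' <;> rcases y with (y | y) | (y | y) <;>
    simp only [Corresp] at hx hz
  · rw [hx, hz]
  · rw [hx.top_unique hR₁ hz]
  · rw [hx.bot_unique hz]
  · rw [hx, hz]

/-- The elements lying in nonbasic blocks. -/
noncomputable def nbSupport (f g : Fin r → Fin k)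
    (R : Fin r ⊕ Fin r → Fin r ⊕ Fin r → Prop) : Finset (Fin r ⊕ Fin r) :=
  univ.filter fun x => isNonbasic (colBlock f g R x)

lemma mem_nbSupport {x : Fin r ⊕ Fin r} :
    x ∈ nbSupport f g R ↔ isNonbasic (colBlock f g R x) := by
  simp [nbSupport]

lemma exists_corresp (hR₁ : Equivalence R₁) (hR₂ : Equivalence R₂) (hE : Equivalence N)
    (hN : IsStack R₁ R₂ N) {x : Fin r ⊕ Fin r} (hx : x ∈ nbSupport f h N) :
    ∃ y ∈ (nbSupport f g R₁).disjSum (nbSupport g h R₂), Corresp f g h R₁ R₂ x y := by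
  rw [mem_nbSupport] at hx
  rcases x with t | u
  · rcases nonbasic_top (g := g) hR₁ hR₂ hE hN hx with ht | ⟨m, hb, hm⟩
    · exact ⟨.inl (.inl t), by simpa [mem_nbSupport] using ht, rfl⟩
    · exact ⟨.inr (.inl m), by simpa [mem_nbSupport] using hm, hb⟩
  · rcases nonbasic_bot (g := g) hR₁ hR₂ hE hN hx with hu | ⟨m, hb, hm⟩
    · exact ⟨.inr (.inr u), by simpa [mem_nbSupport] using hu, rfl⟩
    · exact ⟨.inl (.inr m), by simpa [mem_nbSupport] using hm, hb⟩

/-- If the supports of the nonbasic blocks have matching sizes, then every colored block has as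
many nonbasic elements in the product as in the two factors together. -/
lemma card_filter_colBlock (hR₁ : Equivalence R₁) (hR₂ : Equivalence R₂) (hE : Equivalence N)
    (hN : IsStack R₁ R₂ N)
    (hcard : (nbSupport f h N).card = (nbSupport f g R₁).card + (nbSupport g h R₂).card)
    (S : Multiset (Fin k ⊕ Fin k)) :
    ((nbSupport f h N).filter fun x => colBlock f h N x = S).card =
      ((nbSupport f g R₁).filter fun x => colBlock f g R₁ x = S).card +
        ((nbSupport g h R₂).filter fun x => colBlock g h R₂ x = S).card := by
  choose! φ hφ hcor using fun x (hx : x ∈ nbSupport f h N) =>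
    exists_corresp (g := g) hR₁ hR₂ hE hN hx
  have hinj : Set.InjOn φ (nbSupport f h N) := fun x hx x' hx' hxx' =>
    (hcor x hx).left_unique hR₁ (hxx' ▸ hcor x' hx')
  have himg : (nbSupport f h N).image φ = (nbSupport f g R₁).disjSum (nbSupport g h R₂) := by
    apply eq_of_subset_of_card_le
    · exact image_subset_iff.2 hφ
    · rw [card_image_of_injOn hinj, card_disjSum, hcard]
  have hsurj : ∀ y ∈ (nbSupport f g R₁).disjSum (nbSupport g h R₂),
      ∃ x, Corresp f g h R₁ R₂ x y := fun y hy => by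
    rw [← himg, mem_image] at hy
    obtain ⟨x, hx, rfl⟩ := hy
    exact ⟨x, hcor x hx⟩
  have hlow : ∀ m, isNonbasic (colBlock f g R₁ (.inr m)) → ∃ u, BarAt g h R₂ m u := by
    intro m hm
    obtain ⟨x | x, hx⟩ := hsurj (.inl (.inr m)) (by simpa [mem_nbSupport] using hm)
    · exact hx.elim
    · exact ⟨x, hx⟩
  have hupp : ∀ m, isNonbasic (colBlock g h R₂ (.inl m)) → ∃ t, BarAt f g R₁ t m := by
    intro m hm
    obtain ⟨x | x, hx⟩ := hsurj (.inr (.inl m)) (by simpa [mem_nbSupport] using hm)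
    · exact ⟨x, hx⟩
    · exact hx.elim
  obtain ⟨q, hq⟩ : ∃ q : Fin r → Fin r,
      ∀ m, isNonbasic (colBlock f g R₁ (.inr m)) → BarAt g h R₂ m (q m) :=
    ⟨fun m => if hm : isNonbasic (colBlock f g R₁ (.inr m)) then (hlow m hm).choose else m,
      fun m hm => by simpa [hm] using (hlow m hm).choose_spec⟩
  obtain ⟨p, hp⟩ : ∃ p : Fin r → Fin r,
      ∀ m, isNonbasic (colBlock g h R₂ (.inl m)) → BarAt f g R₁ (p m) m :=
    ⟨fun m => if hm : isNonbasic (colBlock g h R₂ (.inl m)) then (hupp m hm).choose else m,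
      fun m hm => by simpa [hm] using (hupp m hm).choose_spec⟩
  have hcol : ∀ x ∈ nbSupport f h N,
      Sum.elim (colBlock f g R₁) (colBlock g h R₂) (φ x) = colBlock f h N x := by
    intro x hx
    have hmem := hφ x hx
    have hc := hcor x hx
    rcases hy : φ x with y | y
    · rw [hy, inl_mem_disjSum, mem_nbSupport] at hmem
      rw [Sum.elim_inl, ← colBlock_eq_upper hR₁ hR₂ hN hq hmem]
      congr 1
      refine Corresp.left_unique (y := .inl y) hR₁ ?_ (hy ▸ hc)
      rcases y with y | y
      exacts [rfl, hq y hmem]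
    · rw [hy, inr_mem_disjSum, mem_nbSupport] at hmem
      rw [Sum.elim_inr, ← colBlock_eq_lower hR₁ hR₂ hN hp hmem]
      congr 1
      refine Corresp.left_unique (y := .inr y) hR₁ ?_ (hy ▸ hc)
      rcases y with y | y
      exacts [hp y hmem, rfl]
  have hsum : ((nbSupport f g R₁).filter fun x => colBlock f g R₁ x = S).disjSum
      ((nbSupport g h R₂).filter fun x => colBlock g h R₂ x = S) =
      ((nbSupport f g R₁).disjSum (nbSupport g h R₂)).filter
        fun y => Sum.elim (colBlock f g R₁) (colBlock g h R₂) y = S := by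
    ext (y | y) <;> simp
  rw [← card_disjSum, hsum, ← himg, filter_image, card_image_of_injOn]
  · congr 1
    refine filter_congr fun x hx => ?_
    rw [hcol x hx]
  · exact hinj.mono fun x hx => (mem_filter.1 hx).1

end Relations

section Partitions

variable {P : Finpartition (univ : Finset (Fin r ⊕ Fin r))} {f g : Fin r → Fin k}

lemma memRel_iff_of_mem {B : Finset (Fin r ⊕ Fin r)} (hB : B ∈ P.parts) {x y : Fin r ⊕ Fin r}
    (hx : x ∈ B) : memRel P x y ↔ y ∈ B := by
  constructor
  · rintro ⟨C, hC, hxC, hyC⟩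
    rwa [P.eq_of_mem_parts hB hC hx hxC]
  · exact fun hy => ⟨B, hB, hx, hy⟩

lemma equivalence_memRel : Equivalence (memRel P) where
  refl x := by
    obtain ⟨B, hB, hx⟩ := P.exists_mem (mem_univ x)
    exact ⟨B, hB, hx, hx⟩
  symm := fun ⟨B, hB, hx, hy⟩ => ⟨B, hB, hy, hx⟩
  trans := fun ⟨B, hB, hx, hy⟩ hyz => ⟨B, hB, hx, (memRel_iff_of_mem hB hy).1 hyz⟩

lemma colBlock_memRel {B : Finset (Fin r ⊕ Fin r)} (hB : B ∈ P.parts) {x : Fin r ⊕ Fin r}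
    (hx : x ∈ B) : colBlock f g (memRel P) x = B.val.map (colorOf f g) := by
  have : relBlock (memRel P) x = B := by
    ext y
    rw [mem_relBlock, memRel_iff_of_mem hB hx]
  rw [colBlock, this]

/-- Counting elements by their colored block amounts to counting blocks weighted by size. -/
lemma card_filter_colBlock_memRel (p : Multiset (Fin k ⊕ Fin k) → Prop) [DecidablePred p] :
    (univ.filter fun x => p (colBlock f g (memRel P) x)).card =
      (((coloredP f g P).filter p).map Multiset.card).sum := by
  have h1 : (univ.filter fun x => p (colBlock f g (memRel P) x)).card =
      ∑ B ∈ P.parts, if p (B.val.map (colorOf f g)) then B.card else 0 := by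
    have hU : ∀ F : Fin r ⊕ Fin r → ℕ, ∑ x, F x = ∑ B ∈ P.parts, ∑ x ∈ B, F x := fun F =>
      (sum_congr P.biUnion_parts.symm fun _ _ => rfl).trans (sum_biUnion P.disjoint)
    rw [card_filter, hU]
    refine sum_congr rfl fun B hB => ?_
    rw [sum_congr rfl fun x hx => by rw [colBlock_memRel hB hx]]
    split_ifs <;> simp
  rw [h1, coloredP, Multiset.filter_map, Multiset.map_map, ← sum_filter, sum_eq_multiset_sum,
    filter_val]
  simp [Function.comp_def]

lemma nbw_eq_card : nbw (coloredP f g P) = (nbSupport f g (memRel P)).card :=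
  (card_filter_colBlock_memRel isNonbasic).symm

lemma count_nbBlocks_mul_card (S : Multiset (Fin k ⊕ Fin k)) :
    (nbBlocks (coloredP f g P)).count S * S.card =
      ((nbSupport f g (memRel P)).filter fun x => colBlock f g (memRel P) x = S).card := by
  have hfilter : (coloredP f g P).filter (fun T => isNonbasic T ∧ T = S) =
      ((coloredP f g P).filter isNonbasic).filter (Eq S) := by
    rw [Multiset.filter_filter]
    exact Multiset.filter_congr fun T _ => by rw [and_comm, eq_comm]
  have hcount := card_filter_colBlock_memRel (P := P) (f := f) (g := g)
    fun T => isNonbasic T ∧ T = S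
  rw [hfilter, Multiset.filter_eq, Multiset.map_replicate, Multiset.sum_replicate, smul_eq_mul]
    at hcount
  rw [nbBlocks, ← hcount, nbSupport, filter_filter]

lemma count_zero_nbBlocks : (nbBlocks (coloredP f g P)).count 0 = 0 := by
  refine Multiset.count_eq_zero.2 fun h0 => ?_
  obtain ⟨B, hB, hB0⟩ := Multiset.mem_map.1 (Multiset.mem_filter.1 h0).1
  rw [Multiset.map_eq_zero, val_eq_zero] at hB0
  exact P.ne_bot hB hB0

end Partitions

/-- With notation as in the nonbasic weight lemma (so `D_ν̃` appears
with nonzero coefficient in `D_{π̃₁} D_{π̃₂}`, witnessed by a snapshot `(π₁, π₂)` with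
diagram product `ν`), the equality `nbw(ν̃) = nbw(π̃₁) + nbw(π̃₂)` holds if and only if
the multiset of nonbasic blocks of `ν̃` equals the multiset union of those of `π̃₁`
and `π̃₂`: `N(ν̃) = N(π̃₁) ⊎ N(π̃₂)`. -/
theorem stmt13 (f g h : Fin r → Fin k) (hf : Monotone f) (hg : Monotone g)
    (hh : Monotone h)
    (π₁ π₂ ν : Finpartition (univ : Finset (Fin r ⊕ Fin r)))
    (hprod : IsDiagramProduct π₁ π₂ ν) :
    nbw (coloredP f h ν) = nbw (coloredP f g π₁) + nbw (coloredP g h π₂) ↔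
      nbBlocks (coloredP f h ν) = nbBlocks (coloredP f g π₁) + nbBlocks (coloredP g h π₂) := by
  refine ⟨fun hw => ?_, fun hb => by rw [nbw, hb, Multiset.map_add, Multiset.sum_add, nbw, nbw]⟩
  rw [nbw_eq_card, nbw_eq_card, nbw_eq_card] at hw
  ext S
  rw [Multiset.count_add]
  rcases eq_or_ne S 0 with rfl | hS
  · simp only [count_zero_nbBlocks]
  · refine Nat.eq_of_mul_eq_mul_right (Multiset.card_pos.2 hS) ?_
    rw [add_mul, count_nbBlocks_mul_card, count_nbBlocks_mul_card, count_nbBlocks_mul_card]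
    exact card_filter_colBlock equivalence_memRel equivalence_memRel equivalence_memRel hprod hw S
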